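/- arXiv:1910.02722 — 10 statements merged into one kernel-verified Lean document; each statement's English description precedes it below -/
import Mathlib

section
/- Let a ≥ 2 and let α : Fin a → ℝ satisfy ∑_i α_i = 0. Let δ = (max_i α_i) − (min_i α_i). Then ∑_i α_i² ≥ δ²/2 (the Szőkefalvi-Nagy inequality). -/
/-- Szőkefalvi-Nagy inequality: for a zero-sum family `α : Fin a → ℝ` with range
`δ = max α - min α`, we have `∑ α i ^ 2 ≥ δ ^ 2 / 2`. -/
theorem stmt_0 (a : ℕ) (ha : 2 ≤ a) (α : Fin a → ℝ)
    (hsum : ∑ i, α i = 0)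
    (δ : ℝ)
    (hδ : δ = Finset.univ.sup' (Finset.univ_nonempty_iff.mpr ⟨⟨0, by omega⟩⟩) α
        - Finset.univ.inf' (Finset.univ_nonempty_iff.mpr ⟨⟨0, by omega⟩⟩) α) :
    ∑ i, (α i) ^ 2 ≥ δ ^ 2 / 2 := by
  have hne : (Finset.univ : Finset (Fin a)).Nonempty :=
    Finset.univ_nonempty_iff.mpr ⟨⟨0, by omega⟩⟩
  obtain ⟨i, -, hi⟩ := Finset.exists_mem_eq_sup' hne α
  obtain ⟨j, -, hj⟩ := Finset.exists_mem_eq_inf' hne α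
  have hd : δ = α i - α j := by rw [hδ, ← hi, ← hj]
  by_cases hij : i = j
  · subst hij
    have h0 : δ = 0 := by rw [hd]; ring
    rw [h0]
    have : 0 ≤ ∑ i, (α i) ^ 2 := Finset.sum_nonneg fun k _ => sq_nonneg _
    linarith
  · have h1 : ∑ k ∈ ({i, j} : Finset (Fin a)), (α k) ^ 2 ≤ ∑ k, (α k) ^ 2 :=
      Finset.sum_le_sum_of_subset_of_nonneg (Finset.subset_univ _) fun k _ _ => sq_nonneg _
    rw [Finset.sum_pair hij] at h1
    rw [hd]
    nlinarith [sq_nonneg (α i + α j)]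
end

section
/- Let v ≥ 2 and a ≥ 2, and let α : Fin v → Fin a → ℝ be a matrix all of whose row sums and all of whose column sums are zero, i.e. ∑_i α_{j,i} = 0 for every j and ∑_j α_{j,i} = 0 for every i. Let δ be the difference between the largest and the smallest entry of α, and let m = max(v, a). Then ∑_{j,i} α_{j,i}² ≥ (δ²/2) · m/(m−1). -/
lemma aux_line {n : ℕ} (f : Fin n → ℝ) (hf : ∑ i, f i = 0) (k : Fin n) :
    (n : ℝ) * f k ^ 2 ≤ ((n : ℝ) - 1) * ∑ i, f i ^ 2 := by
  have h1 := Finset.add_sum_erase Finset.univ f (Finset.mem_univ k)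
  have h2 := Finset.add_sum_erase Finset.univ (fun i => f i ^ 2) (Finset.mem_univ k)
  have h3 := sq_sum_le_card_mul_sum_sq (s := Finset.univ.erase k) (f := f)
  have hn : 1 ≤ n := by have := k.2; omega
  rw [Finset.card_erase_of_mem (Finset.mem_univ k), Finset.card_univ, Fintype.card_fin,
    Nat.cast_sub hn, Nat.cast_one] at h3
  have h4 : ∑ i ∈ Finset.univ.erase k, f i = - f k := by linarith
  rw [h4] at h3
  rw [← h2]
  nlinarith

lemma aux_mat {r n m : ℕ} (hn : 2 ≤ n) (hnm : n ≤ m) (β : Fin r → Fin n → ℝ)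
    (h0 : ∀ j, ∑ i, β j i = 0) (j₁ j₂ : Fin r) (hj : j₁ ≠ j₂) (i₁ i₂ : Fin n) :
    (β j₁ i₁ - β j₂ i₂) ^ 2 / 2 * ((m : ℝ) / ((m : ℝ) - 1)) ≤ ∑ j, ∑ i, β j i ^ 2 := by
  have h1 := aux_line (β j₁) (h0 j₁) i₁
  have h2 := aux_line (β j₂) (h0 j₂) i₂
  have h3 : ∑ i, β j₁ i ^ 2 + ∑ i, β j₂ i ^ 2 ≤ ∑ j, ∑ i, β j i ^ 2 := by
    rw [← Finset.sum_pair (f := fun j => ∑ i, β j i ^ 2) hj]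
    exact Finset.sum_le_sum_of_subset_of_nonneg (Finset.subset_univ _)
      (fun j _ _ => Finset.sum_nonneg fun i _ => sq_nonneg _)
  have hn' : (2 : ℝ) ≤ n := by exact_mod_cast hn
  have hm' : (n : ℝ) ≤ m := by exact_mod_cast hnm
  have h4 : (m : ℝ) / ((m : ℝ) - 1) ≤ (n : ℝ) / ((n : ℝ) - 1) := by
    rw [div_le_div_iff₀ (by linarith) (by linarith)]
    nlinarith
  refine (mul_le_mul_of_nonneg_left h4 (by positivity)).trans (le_trans ?_ h3)
  rw [← mul_div_assoc, div_le_iff₀ (by linarith)]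
  nlinarith [mul_nonneg (by linarith : (0 : ℝ) ≤ n) (sq_nonneg (β j₁ i₁ + β j₂ i₂))]

/-- Lower bound for the sum of squares of a `v × a` matrix with vanishing row and
column sums, in terms of the range `δ` of its entries and `m = max v a`:
`∑ α j i ^ 2 ≥ (δ ^ 2 / 2) * m / (m - 1)`. -/
theorem stmt_2 (v a : ℕ) (hv : 2 ≤ v) (ha : 2 ≤ a) (α : Fin v → Fin a → ℝ)
    (hrow : ∀ j, ∑ i, α j i = 0) (hcol : ∀ i, ∑ j, α j i = 0)
    (δ : ℝ)
    (hδ : δ = Finset.univ.sup'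
          (Finset.univ_nonempty_iff.mpr ⟨(⟨0, by omega⟩, ⟨0, by omega⟩)⟩)
          (fun p : Fin v × Fin a => α p.1 p.2)
        - Finset.univ.inf'
          (Finset.univ_nonempty_iff.mpr ⟨(⟨0, by omega⟩, ⟨0, by omega⟩)⟩)
          (fun p : Fin v × Fin a => α p.1 p.2))
    (m : ℕ) (hm : m = max v a) :
    ∑ j, ∑ i, (α j i) ^ 2 ≥ δ ^ 2 / 2 * ((m : ℝ) / ((m : ℝ) - 1)) := by
  obtain ⟨p, -, hp⟩ := Finset.exists_mem_eq_sup'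
    (Finset.univ_nonempty_iff.mpr ⟨(⟨0, by omega⟩, ⟨0, by omega⟩)⟩)
    (fun p : Fin v × Fin a => α p.1 p.2)
  obtain ⟨q, -, hq⟩ := Finset.exists_mem_eq_inf'
    (Finset.univ_nonempty_iff.mpr ⟨(⟨0, by omega⟩, ⟨0, by omega⟩)⟩)
    (fun p : Fin v × Fin a => α p.1 p.2)
  rw [hp, hq] at hδ
  subst hδ
  by_cases h1 : p.1 = q.1
  · by_cases h2 : p.2 = q.2
    · simp only [h1, h2, sub_self, ge_iff_le]
      have : 0 ≤ ∑ j, ∑ i, (α j i) ^ 2 :=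
        Finset.sum_nonneg fun j _ => Finset.sum_nonneg fun i _ => sq_nonneg _
      simpa using this
    · rw [Finset.sum_comm]
      exact aux_mat hv (by omega) (fun i j => α j i) hcol p.2 q.2 h2 p.1 q.1
  · exact aux_mat ha (by omega) α hrow p.1 q.1 h1 p.2 q.2
end

section
/- Let u, v, a ≥ 2 and let α : Fin u → Fin v → Fin a → ℝ be a three-dimensional array all of whose one-dimensional fiber sums vanish, i.e. ∑_i α_{k,j,i} = 0 for all k, j, ∑_j α_{k,j,i} = 0 for all k, i, and ∑_k α_{k,j,i} = 0 for all j, i. Let δ be the difference between the largest and the smallest entry of α, and let m₁ ≤ m₂ ≤ m₃ be the values a, u, v sorted from least to greatest. Then ∑_{k,j,i} α_{k,j,i}² ≥ (δ²/2) · m₂ m₃ / ((m₂−1)(m₃−1)). -/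
/-- Centered indicator. -/
noncomputable def cind (n : ℕ) (x i : Fin n) : ℝ := (if i = x then 1 else 0) - 1 / (n : ℝ)

lemma cind_sum (n : ℕ) (x : Fin n) (f : Fin n → ℝ) (hf : ∑ i, f i = 0) :
    ∑ i, f i * cind n x i = f x := by
  simp only [cind, mul_sub, Finset.sum_sub_distrib, ← Finset.sum_mul, hf]
  simp

lemma cind_total (n : ℕ) (hn : 2 ≤ n) (x : Fin n) : ∑ i, cind n x i = 0 := by
  have : (n : ℝ) ≠ 0 := by positivity
  simp [cind, Finset.sum_sub_distrib, this]

lemma cind_mul (n : ℕ) (hn : 2 ≤ n) (x y : Fin n) :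
    ∑ i, cind n x i * cind n y i = cind n x y :=
  cind_sum n y _ (cind_total n hn x)

lemma cind_cases (n : ℕ) (x y : Fin n) :
    cind n x y = 1 - 1 / (n : ℝ) ∨ cind n x y = - (1 / (n : ℝ)) := by
  unfold cind
  split_ifs <;> simp

lemma cind_self (n : ℕ) (x : Fin n) : cind n x x = 1 - 1 / (n : ℝ) := by
  simp [cind]

lemma three_bound (P Q R M p q r : ℝ) (hP : 0 ≤ P) (hQ : 0 ≤ Q) (hR : 0 ≤ R)
    (hP' : P ≤ 1 / 2) (hQ' : Q ≤ 1 / 2) (hR' : R ≤ 1 / 2)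
    (h1 : (1 - P) * (1 - Q) ≤ M) (h2 : (1 - P) * (1 - R) ≤ M) (h3 : (1 - Q) * (1 - R) ≤ M)
    (hp : p = 1 - P ∨ p = -P) (hq : q = 1 - Q ∨ q = -Q) (hr : r = 1 - R ∨ r = -R) :
    (1 - P) * (1 - Q) * (1 - R) - p * q * r ≤ M := by
  have a1 : 0 ≤ 1 - P := by linarith
  have a2 : 0 ≤ 1 - Q := by linarith
  have a3 : 0 ≤ 1 - R := by linarith
  have b0 := mul_nonneg (mul_nonneg a1 a2) a3
  have b1 := mul_nonneg a1 a2
  have b2 := mul_nonneg b1 hR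
  have c1 := mul_nonneg (mul_nonneg a1 hQ) hR
  have c2 := mul_nonneg (mul_nonneg hP a2) hR
  have c3 := mul_nonneg (mul_nonneg hP hQ) a3
  have d : 0 ≤ R * (1 - P - Q) := mul_nonneg hR (by linarith)
  rcases hp with rfl | rfl <;> rcases hq with rfl | rfl <;> rcases hr with rfl | rfl <;>
    nlinarith

lemma perm_cases (m₁ m₂ m₃ a u v : ℕ) (h : ({m₁, m₂, m₃} : Multiset ℕ) = {a, u, v}) :
    (m₁ = a ∧ m₂ = u ∧ m₃ = v) ∨ (m₁ = a ∧ m₂ = v ∧ m₃ = u) ∨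
    (m₁ = u ∧ m₂ = a ∧ m₃ = v) ∨ (m₁ = u ∧ m₂ = v ∧ m₃ = a) ∨
    (m₁ = v ∧ m₂ = a ∧ m₃ = u) ∨ (m₁ = v ∧ m₂ = u ∧ m₃ = a) := by
  have h' : [m₁, m₂, m₃].Perm [a, u, v] := Multiset.coe_eq_coe.mp h
  rw [List.cons_perm_iff_perm_erase, List.cons_perm_iff_perm_erase,
    List.cons_perm_iff_perm_erase] at h'
  grind

lemma range_bound (u v a : ℕ) (hu : 2 ≤ u) (hv : 2 ≤ v) (ha : 2 ≤ a)
    (α : Fin u → Fin v → Fin a → ℝ)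
    (h1 : ∀ k j, ∑ i, α k j i = 0)
    (h2 : ∀ k i, ∑ j, α k j i = 0)
    (h3 : ∀ j i, ∑ k, α k j i = 0)
    (x y : Fin u × Fin v × Fin a) (M : ℝ)
    (e1 : (1 - 1 / (u : ℝ)) * (1 - 1 / (v : ℝ)) ≤ M)
    (e2 : (1 - 1 / (u : ℝ)) * (1 - 1 / (a : ℝ)) ≤ M)
    (e3 : (1 - 1 / (v : ℝ)) * (1 - 1 / (a : ℝ)) ≤ M) :
    (α x.1 x.2.1 x.2.2 - α y.1 y.2.1 y.2.2) ^ 2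
      ≤ (∑ k, ∑ j, ∑ i, (α k j i) ^ 2) * (2 * M) := by
  let w : Fin u × Fin v × Fin a → Fin u × Fin v × Fin a → ℝ := fun x p =>
    cind u x.1 p.1 * cind v x.2.1 p.2.1 * cind a x.2.2 p.2.2
  let A : Fin u × Fin v × Fin a → ℝ := fun p => α p.1 p.2.1 p.2.2
  have hA : ∀ x, ∑ p, A p * w x p = A x := by
    intro x
    have t1 : ∀ k j, ∑ i, α k j i * (cind u x.1 k * cind v x.2.1 j * cind a x.2.2 i)
        = α k j x.2.2 * cind v x.2.1 j * cind u x.1 k := by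
      intro k j
      rw [← cind_sum a x.2.2 (α k j) (h1 k j), Finset.sum_mul, Finset.sum_mul]
      exact Finset.sum_congr rfl fun i _ => by ring
    have t2 : ∀ k, ∑ j, α k j x.2.2 * cind v x.2.1 j * cind u x.1 k
        = α k x.2.1 x.2.2 * cind u x.1 k := by
      intro k
      rw [← Finset.sum_mul, cind_sum v x.2.1 (fun j => α k j x.2.2) (h2 k _)]
    simp only [Fintype.sum_prod_type, A, w, t1, t2]
    exact cind_sum u x.1 (fun k => α k x.2.1 x.2.2) (h3 _ _)
  have hw : ∀ x y, ∑ p, w x p * w y p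
      = cind u x.1 y.1 * cind v x.2.1 y.2.1 * cind a x.2.2 y.2.2 := by
    intro x y
    rw [← cind_mul u hu, ← cind_mul v hv, ← cind_mul a ha]
    simp only [Fintype.sum_prod_type, w]
    rw [Finset.sum_mul, Finset.sum_mul]
    refine Finset.sum_congr rfl fun k _ => ?_
    rw [mul_assoc, Finset.sum_mul, Finset.mul_sum]
    refine Finset.sum_congr rfl fun j _ => ?_
    rw [Finset.mul_sum, Finset.mul_sum]
    exact Finset.sum_congr rfl fun i _ => by ring
  have hcs := Finset.sum_mul_sq_le_sq_mul_sq Finset.univ A (fun p => w x p - w y p)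
  have l1 : ∑ p, A p * (w x p - w y p) = A x - A y := by
    simp only [mul_sub, Finset.sum_sub_distrib, hA]
  have l2 : ∑ p, (w x p - w y p) ^ 2
      = ∑ p, w x p * w x p + ∑ p, w y p * w y p - 2 * ∑ p, w x p * w y p := by
    rw [Finset.mul_sum, ← Finset.sum_add_distrib, ← Finset.sum_sub_distrib]
    exact Finset.sum_congr rfl fun i _ => by ring
  have half : ∀ n : ℕ, 2 ≤ n → 1 / (n : ℝ) ≤ 1 / 2 := by
    intro n hn
    exact one_div_le_one_div_of_le (by norm_num) (by exact_mod_cast hn)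
  have hb := three_bound (1 / u) (1 / v) (1 / a) M _ _ _ (by positivity) (by positivity)
    (by positivity) (half u hu) (half v hv) (half a ha) e1 e2 e3
    (cind_cases u x.1 y.1) (cind_cases v x.2.1 y.2.1) (cind_cases a x.2.2 y.2.2)
  have l3 : ∑ p, (w x p - w y p) ^ 2 ≤ 2 * M := by
    rw [l2, hw, hw, hw]
    simp only [cind_self]
    linarith
  have l4 : ∑ p, A p ^ 2 = ∑ k, ∑ j, ∑ i, (α k j i) ^ 2 := by
    simp only [Fintype.sum_prod_type, A]
  rw [l1] at hcs
  rw [← l4]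
  exact hcs.trans (mul_le_mul_of_nonneg_left l3 (Finset.sum_nonneg fun _ _ => sq_nonneg _))

/-- Lower bound for the sum of squares of a `u × v × a` array with vanishing
one-dimensional fiber sums, in terms of the range `δ` of its entries and the
two largest values `m₂ ≤ m₃` among `a, u, v`. -/
theorem stmt_3 (u v a : ℕ) (hu : 2 ≤ u) (hv : 2 ≤ v) (ha : 2 ≤ a)
    (α : Fin u → Fin v → Fin a → ℝ)
    (h1 : ∀ k j, ∑ i, α k j i = 0)
    (h2 : ∀ k i, ∑ j, α k j i = 0)
    (h3 : ∀ j i, ∑ k, α k j i = 0)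
    (δ : ℝ)
    (hδ : δ = Finset.univ.sup'
          (Finset.univ_nonempty_iff.mpr ⟨(⟨0, by omega⟩, ⟨0, by omega⟩, ⟨0, by omega⟩)⟩)
          (fun p : Fin u × Fin v × Fin a => α p.1 p.2.1 p.2.2)
        - Finset.univ.inf'
          (Finset.univ_nonempty_iff.mpr ⟨(⟨0, by omega⟩, ⟨0, by omega⟩, ⟨0, by omega⟩)⟩)
          (fun p : Fin u × Fin v × Fin a => α p.1 p.2.1 p.2.2))
    (m₁ m₂ m₃ : ℕ) (h12 : m₁ ≤ m₂) (h23 : m₂ ≤ m₃)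
    (hperm : ({m₁, m₂, m₃} : Multiset ℕ) = {a, u, v}) :
    ∑ k, ∑ j, ∑ i, (α k j i) ^ 2
      ≥ δ ^ 2 / 2 * ((m₂ : ℝ) * (m₃ : ℝ) / (((m₂ : ℝ) - 1) * ((m₃ : ℝ) - 1))) := by
  have mem := perm_cases _ _ _ _ _ _ hperm
  have g1 : 2 ≤ m₁ := by omega
  have mono : ∀ m n : ℕ, 2 ≤ m → m ≤ n → 1 - 1 / (m : ℝ) ≤ 1 - 1 / (n : ℝ) := by
    intro m n hm hmn
    have : 1 / (n : ℝ) ≤ 1 / (m : ℝ) :=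
      one_div_le_one_div_of_le (by positivity) (by exact_mod_cast hmn)
    linarith
  have pos : ∀ m : ℕ, 2 ≤ m → 0 < 1 - 1 / (m : ℝ) := by
    intro m hm
    have : 1 / (m : ℝ) ≤ 1 / 2 :=
      one_div_le_one_div_of_le (by norm_num) (by exact_mod_cast hm)
    linarith
  have p1 := pos m₁ g1
  have p2 := pos m₂ (by omega)
  have p3 := pos m₃ (by omega)
  have q12 := mono m₁ m₂ g1 h12
  have q23 := mono m₂ m₃ (by omega) h23
  have r12 : (1 - 1 / (m₁ : ℝ)) * (1 - 1 / (m₂ : ℝ)) ≤ (1 - 1 / (m₂ : ℝ)) * (1 - 1 / (m₃ : ℝ)) := by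
    nlinarith
  have r13 : (1 - 1 / (m₁ : ℝ)) * (1 - 1 / (m₃ : ℝ)) ≤ (1 - 1 / (m₂ : ℝ)) * (1 - 1 / (m₃ : ℝ)) := by
    nlinarith
  have hM := mul_pos p2 p3
  have hform : (m₂ : ℝ) * (m₃ : ℝ) / (((m₂ : ℝ) - 1) * ((m₃ : ℝ) - 1))
      = 1 / ((1 - 1 / (m₂ : ℝ)) * (1 - 1 / (m₃ : ℝ))) := by
    have n2 : (m₂ : ℝ) ≠ 0 := by
      have : m₂ ≠ 0 := by omega
      exact_mod_cast this
    have n3 : (m₃ : ℝ) ≠ 0 := by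
      have : m₃ ≠ 0 := by omega
      exact_mod_cast this
    rw [one_sub_div n2, one_sub_div n3, div_mul_div_comm, one_div_div]
  rw [hform]
  generalize hMe : (1 - 1 / (m₂ : ℝ)) * (1 - 1 / (m₃ : ℝ)) = M at *
  have e : (1 - 1 / (u : ℝ)) * (1 - 1 / (v : ℝ)) ≤ M ∧
      (1 - 1 / (u : ℝ)) * (1 - 1 / (a : ℝ)) ≤ M ∧
      (1 - 1 / (v : ℝ)) * (1 - 1 / (a : ℝ)) ≤ M := by
    rcases mem with ⟨rfl, rfl, rfl⟩ | ⟨rfl, rfl, rfl⟩ | ⟨rfl, rfl, rfl⟩ | ⟨rfl, rfl, rfl⟩ |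
      ⟨rfl, rfl, rfl⟩ | ⟨rfl, rfl, rfl⟩ <;> refine ⟨?_, ?_, ?_⟩ <;> linarith
  obtain ⟨e1, e2, e3⟩ := e
  have hne : (Finset.univ : Finset (Fin u × Fin v × Fin a)).Nonempty :=
    Finset.univ_nonempty_iff.mpr ⟨(⟨0, by omega⟩, ⟨0, by omega⟩, ⟨0, by omega⟩)⟩
  obtain ⟨x, -, hx⟩ := Finset.exists_mem_eq_sup' hne
    (fun p : Fin u × Fin v × Fin a => α p.1 p.2.1 p.2.2)
  obtain ⟨y, -, hy⟩ := Finset.exists_mem_eq_inf' hne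
    (fun p : Fin u × Fin v × Fin a => α p.1 p.2.1 p.2.2)
  have key := range_bound u v a hu hv ha α h1 h2 h3 x y M e1 e2 e3
  have hd : δ = α x.1 x.2.1 x.2.2 - α y.1 y.2.1 y.2.2 := by
    rw [hδ, hx, hy]
  rw [← hd] at key
  rw [ge_iff_le, mul_one_div, div_le_iff₀ hM]
  linarith
end

section
/- Let a ≥ 2, let α : Fin a → ℝ satisfy ∑_i α_i = 0, and set δ = (max_i α_i) − (min_i α_i). Let b, c, n ≥ 1 be real numbers and let σβ², σγ², σ² ≥ 0 with σ_active² := σβ² + σγ² + σ² > 0. Define the noncentrality parameter λ = b·c·n·(∑_i α_i²) / (σ² + n·σγ² + c·n·σβ²). Then λ ≥ (b/2) · δ² / σ_active². -/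
/-- Least favorable case bound for the noncentrality parameter of the exact
F-test in the balanced model `A ≻ B ≻ C` with `B, C` random, in terms of the sum
of the active variance components `σβ² + σγ² + σ²`. -/
theorem stmt_4 (a : ℕ) (ha : 2 ≤ a) (α : Fin a → ℝ)
    (hsum : ∑ i, α i = 0)
    (δ : ℝ)
    (hδ : δ = Finset.univ.sup' (Finset.univ_nonempty_iff.mpr ⟨⟨0, by omega⟩⟩) α
        - Finset.univ.inf' (Finset.univ_nonempty_iff.mpr ⟨⟨0, by omega⟩⟩) α)
    (b c n : ℝ) (hb : 1 ≤ b) (hc : 1 ≤ c) (hn : 1 ≤ n)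
    (σβ2 σγ2 σ2 : ℝ) (hβ : 0 ≤ σβ2) (hγ : 0 ≤ σγ2) (hσ : 0 ≤ σ2)
    (hactive : 0 < σβ2 + σγ2 + σ2)
    (lam : ℝ)
    (hlam : lam = b * c * n * (∑ i, (α i) ^ 2) / (σ2 + n * σγ2 + c * n * σβ2)) :
    lam ≥ b / 2 * δ ^ 2 / (σβ2 + σγ2 + σ2) := by
  obtain ⟨i, -, hi⟩ := Finset.exists_mem_eq_sup' (s := Finset.univ)
    (Finset.univ_nonempty_iff.mpr ⟨⟨0, by omega⟩⟩) α
  obtain ⟨j, -, hj⟩ := Finset.exists_mem_eq_inf' (s := Finset.univ)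
    (Finset.univ_nonempty_iff.mpr ⟨⟨0, by omega⟩⟩) α
  rw [hi, hj] at hδ
  have hQ : δ ^ 2 / 2 ≤ ∑ i, (α i) ^ 2 := by
    by_cases hij : i = j
    · subst hij
      have h0 : δ = 0 := by rw [hδ]; ring
      rw [h0]
      have : 0 ≤ ∑ i, (α i) ^ 2 := Finset.sum_nonneg (fun i _ => sq_nonneg _)
      simpa using this
    · have h1 : ∑ k ∈ {i, j}, (α k) ^ 2 ≤ ∑ k, (α k) ^ 2 :=
        Finset.sum_le_sum_of_subset_of_nonneg (Finset.subset_univ _)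
          (fun k _ _ => sq_nonneg _)
      rw [Finset.sum_pair hij] at h1
      rw [hδ]
      nlinarith [sq_nonneg (α i + α j)]
  have hcn : 1 ≤ c * n := by nlinarith
  have hncn : n ≤ c * n := by nlinarith
  have hD : σ2 + n * σγ2 + c * n * σβ2 ≤ c * n * (σβ2 + σγ2 + σ2) := by
    nlinarith [mul_le_mul_of_nonneg_right hncn hγ, mul_le_mul_of_nonneg_right hcn hσ]
  have hDpos : 0 < σ2 + n * σγ2 + c * n * σβ2 := by
    nlinarith [mul_le_mul_of_nonneg_right hn hγ, mul_le_mul_of_nonneg_right hcn hβ]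
  rw [hlam, ge_iff_le, div_le_div_iff₀ hactive hDpos]
  have hQ0 : 0 ≤ ∑ i, (α i) ^ 2 := Finset.sum_nonneg (fun i _ => sq_nonneg _)
  have hb0 : 0 ≤ b := by linarith
  calc b / 2 * δ ^ 2 * (σ2 + n * σγ2 + c * n * σβ2)
      = b * (δ ^ 2 / 2) * (σ2 + n * σγ2 + c * n * σβ2) := by ring
    _ ≤ b * (∑ i, (α i) ^ 2) * (c * n * (σβ2 + σγ2 + σ2)) :=
        mul_le_mul (mul_le_mul_of_nonneg_left hQ hb0) hD hDpos.le (mul_nonneg hb0 hQ0)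
    _ = b * c * n * (∑ i, (α i) ^ 2) * (σβ2 + σγ2 + σ2) := by ring
end

section
/- Let a ≥ 2, let α : Fin a → ℝ satisfy ∑_i α_i = 0, and set δ = (max_i α_i) − (min_i α_i). Let b, c, n ≥ 1 be real numbers, let σβ², σγ², σ² ≥ 0 with σβ² + σγ² + σ² > 0, and let σ_y² be any real number with σ_y² ≥ σβ² + σγ² + σ². Define λ = b·c·n·(∑_i α_i²) / (σ² + n·σγ² + c·n·σβ²). Then λ ≥ (b/2) · δ² / σ_y². -/
/-- Least favorable case bound for the noncentrality parameter of the exact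
F-test in the balanced model `A ≻ B ≻ C` with `B, C` random, in terms of the
total variance `σ_y² ≥ σβ² + σγ² + σ²`. -/
theorem stmt_5 (a : ℕ) (ha : 2 ≤ a) (α : Fin a → ℝ)
    (hsum : ∑ i, α i = 0)
    (δ : ℝ)
    (hδ : δ = Finset.univ.sup' (Finset.univ_nonempty_iff.mpr ⟨⟨0, by omega⟩⟩) α
        - Finset.univ.inf' (Finset.univ_nonempty_iff.mpr ⟨⟨0, by omega⟩⟩) α)
    (b c n : ℝ) (hb : 1 ≤ b) (hc : 1 ≤ c) (hn : 1 ≤ n)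
    (σβ2 σγ2 σ2 : ℝ) (hβ : 0 ≤ σβ2) (hγ : 0 ≤ σγ2) (hσ : 0 ≤ σ2)
    (hactive : 0 < σβ2 + σγ2 + σ2)
    (σy2 : ℝ) (hy : σβ2 + σγ2 + σ2 ≤ σy2)
    (lam : ℝ)
    (hlam : lam = b * c * n * (∑ i, (α i) ^ 2) / (σ2 + n * σγ2 + c * n * σβ2)) :
    lam ≥ b / 2 * δ ^ 2 / σy2 := by
  have hS : δ ^ 2 / 2 ≤ ∑ i, (α i) ^ 2 := by
    obtain ⟨i, -, hi⟩ := Finset.exists_mem_eq_sup'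
      (Finset.univ_nonempty_iff.mpr ⟨(⟨0, by omega⟩ : Fin a)⟩) α
    obtain ⟨j, -, hj⟩ := Finset.exists_mem_eq_inf'
      (Finset.univ_nonempty_iff.mpr ⟨(⟨0, by omega⟩ : Fin a)⟩) α
    rw [hi, hj] at hδ
    by_cases hij : i = j
    · subst hij
      have h0 : δ = 0 := by rw [hδ]; ring
      rw [h0]
      have : 0 ≤ ∑ i, (α i) ^ 2 := Finset.sum_nonneg fun k _ => sq_nonneg _
      simpa using this
    · have h1 : ∑ k ∈ ({i, j} : Finset (Fin a)), (α k) ^ 2 ≤ ∑ k, (α k) ^ 2 :=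
        Finset.sum_le_sum_of_subset_of_nonneg (Finset.subset_univ _)
          fun k _ _ => sq_nonneg _
      rw [Finset.sum_pair hij] at h1
      rw [hδ]
      nlinarith [sq_nonneg (α i + α j)]
  have hcn : 1 ≤ c * n := by nlinarith
  have hncn : n ≤ c * n := by nlinarith
  have hnγ : σγ2 ≤ n * σγ2 := by nlinarith
  have hnγ' : n * σγ2 ≤ c * n * σγ2 := mul_le_mul_of_nonneg_right hncn hγ
  have hnβ : σβ2 ≤ c * n * σβ2 := by nlinarith
  have hnσ : σ2 ≤ c * n * σ2 := by nlinarith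
  have hD : 0 < σ2 + n * σγ2 + c * n * σβ2 := by linarith
  have hy' : c * n * (σβ2 + σγ2 + σ2) ≤ c * n * σy2 :=
    mul_le_mul_of_nonneg_left hy (by linarith)
  have hDle : σ2 + n * σγ2 + c * n * σβ2 ≤ c * n * σy2 := by linarith
  have hypos : 0 < σy2 := by linarith
  rw [hlam, ge_iff_le, div_le_div_iff₀ hypos hD]
  calc b / 2 * δ ^ 2 * (σ2 + n * σγ2 + c * n * σβ2)
      ≤ b / 2 * δ ^ 2 * (c * n * σy2) :=
        mul_le_mul_of_nonneg_left hDle (by positivity)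
    _ = (b * (c * n) * σy2) * (δ ^ 2 / 2) := by ring
    _ ≤ (b * (c * n) * σy2) * ∑ i, (α i) ^ 2 :=
        mul_le_mul_of_nonneg_left hS (by positivity)
    _ = b * c * n * (∑ i, (α i) ^ 2) * σy2 := by ring
end

section
/- Let v ≥ 2 and a ≥ 2, let α : Fin v → Fin a → ℝ have all row sums and all column sums equal to zero, and let δ be the difference between the largest and the smallest entry of α. Let n ≥ 1 be real, σ² > 0, m = max(v, a), and define λ = n·(∑_{j,i} α_{j,i}²)/σ². Then λ ≥ (n/2) · (δ²/σ²) · m/(m−1). -/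
/-- The doubly centered point mass at `(j, i)`. -/
noncomputable def cpm (v a : ℕ) (j : Fin v) (i : Fin a) (s : Fin v) (t : Fin a) : ℝ :=
  ((if s = j then 1 else 0) - 1 / (v : ℝ)) * ((if t = i then 1 else 0) - 1 / (a : ℝ))

lemma cpm_repr (v a : ℕ) (f : Fin v → Fin a → ℝ)
    (hrow : ∀ j, ∑ i, f j i = 0) (hcol : ∀ i, ∑ j, f j i = 0) (j : Fin v) (i : Fin a) :
    ∑ s, ∑ t, f s t * cpm v a j i s t = f j i := by
  have h1 : ∀ s, ∑ t, f s t * cpm v a j i s t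
      = ((if s = j then 1 else 0) - 1 / (v : ℝ)) * f s i := by
    intro s
    have : ∀ t, f s t * cpm v a j i s t
        = ((if s = j then 1 else 0) - 1 / (v : ℝ)) * (if t = i then f s t else 0)
          - ((if s = j then 1 else 0) - 1 / (v : ℝ)) * (1 / (a : ℝ)) * f s t := by
      intro t
      unfold cpm
      by_cases h : t = i <;> simp only [h, if_true, if_false] <;> ring
    rw [Finset.sum_congr rfl (fun t _ => this t), Finset.sum_sub_distrib, ← Finset.mul_sum,
      ← Finset.mul_sum, hrow s]
    simp
  rw [Finset.sum_congr rfl (fun s _ => h1 s)]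
  have h2 : ∀ s, ((if s = j then 1 else 0) - 1 / (v : ℝ)) * f s i
      = (if s = j then f s i else 0) - (1 / (v : ℝ)) * f s i := by
    intro s
    by_cases h : s = j <;> simp only [h, if_true, if_false] <;> ring
  rw [Finset.sum_congr rfl (fun s _ => h2 s), Finset.sum_sub_distrib, ← Finset.mul_sum, hcol i]
  simp

lemma cpm_row (v a : ℕ) (ha : 2 ≤ a) (j : Fin v) (i : Fin a) (s : Fin v) :
    ∑ t, cpm v a j i s t = 0 := by
  have : (a : ℝ) ≠ 0 := by positivity
  unfold cpm
  rw [← Finset.mul_sum, Finset.sum_sub_distrib]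
  simp [this]

lemma cpm_col (v a : ℕ) (hv : 2 ≤ v) (j : Fin v) (i : Fin a) (t : Fin a) :
    ∑ s, cpm v a j i s t = 0 := by
  have : (v : ℝ) ≠ 0 := by positivity
  unfold cpm
  rw [← Finset.sum_mul, Finset.sum_sub_distrib]
  simp [this]

lemma key (v a : ℕ) (hv : 2 ≤ v) (ha : 2 ≤ a) (α : Fin v → Fin a → ℝ)
    (hrow : ∀ j, ∑ i, α j i = 0) (hcol : ∀ i, ∑ j, α j i = 0)
    (j j' : Fin v) (i i' : Fin a) (M : ℝ) (hM1 : (v : ℝ) ≤ M) (hM2 : (a : ℝ) ≤ M) :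
    (α j i - α j' i') ^ 2 ≤ (∑ s, ∑ t, α s t ^ 2) * (2 * (1 - 1 / M)) := by
  let w : Fin v → Fin a → ℝ := fun s t => cpm v a j i s t - cpm v a j' i' s t
  have rep : ∀ f : Fin v → Fin a → ℝ, (∀ j, ∑ i, f j i = 0) → (∀ i, ∑ j, f j i = 0) →
      ∑ s, ∑ t, f s t * w s t = f j i - f j' i' := by
    intro f h1 h2
    simp only [w, mul_sub, Finset.sum_sub_distrib]
    rw [cpm_repr v a f h1 h2, cpm_repr v a f h1 h2]
  have hw := rep w
    (fun s => by simp only [w, Finset.sum_sub_distrib, cpm_row v a ha, sub_zero])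
    (fun t => by simp only [w, Finset.sum_sub_distrib, cpm_col v a hv, sub_zero])
  have hα := rep α hrow hcol
  have cs := Finset.sum_mul_sq_le_sq_mul_sq (Finset.univ : Finset (Fin v × Fin a))
    (fun p => α p.1 p.2) (fun p => w p.1 p.2)
  simp only [Fintype.sum_prod_type] at cs
  rw [hα] at cs
  simp only [pow_two (w _ _)] at cs
  rw [hw] at cs
  refine cs.trans (mul_le_mul_of_nonneg_left ?_ (by positivity))
  have hv' : (2 : ℝ) ≤ v := by exact_mod_cast hv
  have ha' : (2 : ℝ) ≤ a := by exact_mod_cast ha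
  have e1 : 1 / M ≤ 1 / (v : ℝ) := one_div_le_one_div_of_le (by linarith) hM1
  have e2 : 1 / M ≤ 1 / (a : ℝ) := one_div_le_one_div_of_le (by linarith) hM2
  have e0 : 0 < 1 / M := by apply one_div_pos.mpr; linarith
  have e3 : 1 / M ≤ 1 / 2 := one_div_le_one_div_of_le (by norm_num) (by linarith)
  simp only [w, cpm]
  generalize 1 / (v : ℝ) = x at *
  generalize 1 / (a : ℝ) = y at *
  generalize 1 / M = z at *
  by_cases h : j = j'
  · subst h
    by_cases h' : i = i'
    · subst h'
      simp only [if_true]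
      nlinarith
    · simp only [if_true, if_neg h', if_neg (Ne.symm h')]
      nlinarith
  · by_cases h' : i = i'
    · subst h'
      simp only [if_true, if_neg h, if_neg (Ne.symm h)]
      nlinarith
    · simp only [if_true, if_neg h, if_neg (Ne.symm h), if_neg h', if_neg (Ne.symm h')]
      nlinarith

/-- Least favorable case bound for the noncentrality parameter of the exact
F-test in the balanced two-way nested model `V ≻ A` with fixed `A` nested in
`V`, where `m = max v a`. -/
theorem stmt_6 (v a : ℕ) (hv : 2 ≤ v) (ha : 2 ≤ a) (α : Fin v → Fin a → ℝ)
    (hrow : ∀ j, ∑ i, α j i = 0) (hcol : ∀ i, ∑ j, α j i = 0)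
    (δ : ℝ)
    (hδ : δ = Finset.univ.sup'
          (Finset.univ_nonempty_iff.mpr ⟨(⟨0, by omega⟩, ⟨0, by omega⟩)⟩)
          (fun p : Fin v × Fin a => α p.1 p.2)
        - Finset.univ.inf'
          (Finset.univ_nonempty_iff.mpr ⟨(⟨0, by omega⟩, ⟨0, by omega⟩)⟩)
          (fun p : Fin v × Fin a => α p.1 p.2))
    (n σ2 : ℝ) (hn : 1 ≤ n) (hσ : 0 < σ2)
    (m : ℕ) (hm : m = max v a)
    (lam : ℝ) (hlam : lam = n * (∑ j, ∑ i, (α j i) ^ 2) / σ2) :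
    lam ≥ n / 2 * (δ ^ 2 / σ2) * ((m : ℝ) / ((m : ℝ) - 1)) := by
  have hne : (Finset.univ : Finset (Fin v × Fin a)).Nonempty :=
    Finset.univ_nonempty_iff.mpr ⟨(⟨0, by omega⟩, ⟨0, by omega⟩)⟩
  obtain ⟨p, -, hp⟩ := Finset.exists_mem_eq_sup' hne (fun p : Fin v × Fin a => α p.1 p.2)
  obtain ⟨q, -, hq⟩ := Finset.exists_mem_eq_inf' hne (fun p : Fin v × Fin a => α p.1 p.2)
  rw [hp, hq] at hδ
  have hM1 : (v : ℝ) ≤ m := by exact_mod_cast (by omega : v ≤ m)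
  have hM2 : (a : ℝ) ≤ m := by exact_mod_cast (by omega : a ≤ m)
  have hv' : (2 : ℝ) ≤ v := by exact_mod_cast hv
  have hk := key v a hv ha α hrow hcol p.1 q.1 p.2 q.2 m hM1 hM2
  rw [← hδ] at hk
  have hm1 : (0 : ℝ) < (m : ℝ) - 1 := by linarith
  have hm0 : (0 : ℝ) < (m : ℝ) := by linarith
  rw [hlam, ge_iff_le]
  generalize (∑ s, ∑ t, α s t ^ 2) = S at *
  have hk2 : δ ^ 2 / 2 * ((m : ℝ) / ((m : ℝ) - 1)) ≤ S := by
    calc δ ^ 2 / 2 * ((m : ℝ) / ((m : ℝ) - 1))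
        ≤ (S * (2 * (1 - 1 / (m : ℝ)))) / 2 * ((m : ℝ) / ((m : ℝ) - 1)) := by gcongr
      _ = S := by
        have := hm1.ne'
        field_simp
  calc n / 2 * (δ ^ 2 / σ2) * ((m : ℝ) / ((m : ℝ) - 1))
      = n * (δ ^ 2 / 2 * ((m : ℝ) / ((m : ℝ) - 1))) / σ2 := by ring
    _ ≤ n * S / σ2 := by gcongr
end

section
/- Let a ≥ 2, let α : Fin a → ℝ satisfy ∑_i α_i = 0, and set δ = (max_i α_i) − (min_i α_i). Let b ≥ 1 and n ≥ 1 be real, and let σαβ², σ² ≥ 0 with σαβ² + σ² > 0. Define λ = b·(∑_i α_i²) / (σαβ² + σ²/n). Then λ ≥ (b/2) · δ² / (σαβ² + σ²). -/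
/-- Least favorable case bound for the noncentrality parameter of the exact
F-test in the balanced two-way cross-classified model `A × B` with `B` random. -/
theorem stmt_8 (a : ℕ) (ha : 2 ≤ a) (α : Fin a → ℝ)
    (hsum : ∑ i, α i = 0)
    (δ : ℝ)
    (hδ : δ = Finset.univ.sup' (Finset.univ_nonempty_iff.mpr ⟨⟨0, by omega⟩⟩) α
        - Finset.univ.inf' (Finset.univ_nonempty_iff.mpr ⟨⟨0, by omega⟩⟩) α)
    (b n : ℝ) (hb : 1 ≤ b) (hn : 1 ≤ n)
    (σαβ2 σ2 : ℝ) (hαβ : 0 ≤ σαβ2) (hσ : 0 ≤ σ2)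
    (hactive : 0 < σαβ2 + σ2)
    (lam : ℝ)
    (hlam : lam = b * (∑ i, (α i) ^ 2) / (σαβ2 + σ2 / n)) :
    lam ≥ b / 2 * δ ^ 2 / (σαβ2 + σ2) := by
  obtain ⟨i, -, hi⟩ := Finset.exists_mem_eq_sup' (s := Finset.univ)
    (Finset.univ_nonempty_iff.mpr ⟨⟨0, by omega⟩⟩) α
  obtain ⟨j, -, hj⟩ := Finset.exists_mem_eq_inf' (s := Finset.univ)
    (Finset.univ_nonempty_iff.mpr ⟨⟨0, by omega⟩⟩) α
  rw [hi, hj] at hδ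
  have hS : δ ^ 2 / 2 ≤ ∑ i, (α i) ^ 2 := by
    by_cases hij : i = j
    · subst hij
      have h0 : δ = 0 := by rw [hδ]; ring
      rw [h0]
      have : 0 ≤ ∑ i, (α i) ^ 2 := Finset.sum_nonneg fun k _ => sq_nonneg _
      linarith
    · have h1 : ∑ k ∈ ({i, j} : Finset (Fin a)), (α k) ^ 2 ≤ ∑ k, (α k) ^ 2 :=
        Finset.sum_le_sum_of_subset_of_nonneg (Finset.subset_univ _)
          fun k _ _ => sq_nonneg _
      rw [Finset.sum_pair hij] at h1
      rw [hδ]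
      nlinarith [sq_nonneg (α i + α j)]
  have hn0 : 0 < n := by linarith
  have hd1 : σ2 / n ≤ σ2 := div_le_self hσ hn
  have hd : 0 < σαβ2 + σ2 / n := by
    have h2 : 0 ≤ σ2 / n := div_nonneg hσ hn0.le
    rcases hαβ.lt_or_eq with h | h
    · linarith
    · have h3 : 0 < σ2 / n := div_pos (by linarith) hn0
      linarith
  have hS0 : 0 ≤ ∑ i, (α i) ^ 2 := Finset.sum_nonneg fun k _ => sq_nonneg _
  rw [hlam, ge_iff_le]
  apply div_le_div₀ (by positivity) _ hd (by linarith)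
  have := mul_le_mul_of_nonneg_left hS (by linarith : (0 : ℝ) ≤ b)
  linarith
end

section
/- Let a ≥ 2, let α : Fin a → ℝ satisfy ∑_i α_i = 0, and set δ = (max_i α_i) − (min_i α_i). Let b, c, n ≥ 1 be real, let σαβ², σ², σβ², σβγ², σαβγ² ≥ 0 with σαβ² + σ² > 0, and let σ_y² = σαβ² + σ² + σβ² + σβγ² + σαβγ². Define λ = b·(∑_i α_i²) / (σαβ² + σ²/(c·n)). Then λ ≥ (b/2) · δ² / (σαβ² + σ²) ≥ (b/2) · δ² / σ_y². -/
/-- Least favorable case bound for the noncentrality parameter of the exact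
F-test in the balanced three-way cross-classified model `A × B × C` with `B`
random and `A, C` fixed, in terms of the active components `σαβ² + σ²` and the
total variance `σ_y²`. -/
theorem stmt_9 (a : ℕ) (ha : 2 ≤ a) (α : Fin a → ℝ)
    (hsum : ∑ i, α i = 0)
    (δ : ℝ)
    (hδ : δ = Finset.univ.sup' (Finset.univ_nonempty_iff.mpr ⟨⟨0, by omega⟩⟩) α
        - Finset.univ.inf' (Finset.univ_nonempty_iff.mpr ⟨⟨0, by omega⟩⟩) α)
    (b c n : ℝ) (hb : 1 ≤ b) (hc : 1 ≤ c) (hn : 1 ≤ n)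
    (σαβ2 σ2 σβ2 σβγ2 σαβγ2 : ℝ)
    (hαβ : 0 ≤ σαβ2) (hσ : 0 ≤ σ2) (hβ : 0 ≤ σβ2) (hβγ : 0 ≤ σβγ2) (hαβγ : 0 ≤ σαβγ2)
    (hactive : 0 < σαβ2 + σ2)
    (σy2 : ℝ) (hy : σy2 = σαβ2 + σ2 + σβ2 + σβγ2 + σαβγ2)
    (lam : ℝ)
    (hlam : lam = b * (∑ i, (α i) ^ 2) / (σαβ2 + σ2 / (c * n))) :
    lam ≥ b / 2 * δ ^ 2 / (σαβ2 + σ2) ∧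
      b / 2 * δ ^ 2 / (σαβ2 + σ2) ≥ b / 2 * δ ^ 2 / σy2 := by
  have key : δ ^ 2 / 2 ≤ ∑ i, (α i) ^ 2 := by
    obtain ⟨i, -, hi⟩ := Finset.exists_mem_eq_sup'
      (Finset.univ_nonempty_iff.mpr ⟨(⟨0, by omega⟩ : Fin a)⟩) α
    obtain ⟨j, -, hj⟩ := Finset.exists_mem_eq_inf'
      (Finset.univ_nonempty_iff.mpr ⟨(⟨0, by omega⟩ : Fin a)⟩) α
    rw [hi, hj] at hδ
    by_cases hij : i = j
    · subst hij
      have h0 : δ = 0 := by rw [hδ]; ring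
      rw [h0]
      have := Finset.sum_nonneg (s := Finset.univ) (fun k _ => sq_nonneg (α k))
      linarith
    · have h1 : ∑ k ∈ ({i, j} : Finset (Fin a)), (α k) ^ 2 ≤ ∑ k, (α k) ^ 2 :=
        Finset.sum_le_sum_of_subset_of_nonneg (Finset.subset_univ _)
          (fun k _ _ => sq_nonneg (α k))
      rw [Finset.sum_pair hij] at h1
      rw [hδ]
      nlinarith [sq_nonneg (α i + α j)]
  have hcn : 1 ≤ c * n := by nlinarith
  have hle : σ2 / (c * n) ≤ σ2 := div_le_self hσ hcn
  have hpos : 0 < σαβ2 + σ2 / (c * n) := by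
    rcases hσ.eq_or_lt with h | h
    · rw [← h] at hactive ⊢
      simpa using hactive
    · have : 0 < σ2 / (c * n) := by positivity
      linarith
  have hb0 : 0 ≤ b := by linarith
  constructor
  · rw [hlam, ge_iff_le]
    apply div_le_div₀ _ _ hpos (by linarith)
    · exact mul_nonneg hb0 (Finset.sum_nonneg (fun k _ => sq_nonneg (α k)))
    · have := mul_le_mul_of_nonneg_left key hb0
      linarith
  · rw [ge_iff_le]
    apply div_le_div_of_nonneg_left _ hactive (by linarith)
    positivity
end

section
/- Let S ≥ 0, let b, c, n > 0, let σβ², σγ², σ² ≥ 0 with σ² + n·σγ² + c·n·σβ² > 0, and for positive reals b', c', n' define λ(b', c', n') = b'·c'·n'·S / (σ² + n'·σγ² + c'·n'·σβ²). Then for every real t ≥ 1, λ(t·b, c, n) ≥ λ(b, t·c, n) and λ(t·b, c, n) ≥ λ(b, c, t·n); that is, scaling the pivot parameter b increases the noncentrality parameter at least as much as scaling c or n by the same factor. -/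
/-- Pivot effect for the model `A ≻ B ≻ C` with `B, C` random: scaling the pivot
parameter `b` by `t ≥ 1` increases the noncentrality parameter at least as much
as scaling `c` or `n` by the same factor. -/
theorem stmt_12 (S b c n σβ2 σγ2 σ2 : ℝ) (hS : 0 ≤ S)
    (hb : 0 < b) (hc : 0 < c) (hn : 0 < n)
    (hβ : 0 ≤ σβ2) (hγ : 0 ≤ σγ2) (hσ : 0 ≤ σ2)
    (hpos : 0 < σ2 + n * σγ2 + c * n * σβ2)
    (lam : ℝ → ℝ → ℝ → ℝ)
    (hlam : ∀ b' c' n' : ℝ, 0 < b' → 0 < c' → 0 < n' →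
      lam b' c' n' = b' * c' * n' * S / (σ2 + n' * σγ2 + c' * n' * σβ2)) :
    ∀ t : ℝ, 1 ≤ t →
      lam (t * b) c n ≥ lam b (t * c) n ∧ lam (t * b) c n ≥ lam b c (t * n) := by
  intro t ht
  have ht0 : 0 < t := by linarith
  rw [hlam _ _ _ (mul_pos ht0 hb) hc hn, hlam _ _ _ hb (mul_pos ht0 hc) hn,
    hlam _ _ _ hb hc (mul_pos ht0 hn)]
  have hnum : 0 ≤ t * b * c * n * S := by positivity
  have e1 : b * (t * c) * n * S = t * b * c * n * S := by ring
  have e2 : b * c * (t * n) * S = t * b * c * n * S := by ring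
  rw [e1, e2]
  have h1 : 0 ≤ (t - 1) * (n * σγ2) := mul_nonneg (by linarith) (by positivity)
  have h2 : 0 ≤ (t - 1) * (c * n * σβ2) := mul_nonneg (by linarith) (by positivity)
  exact ⟨div_le_div_of_nonneg_left hnum hpos (by linarith),
    div_le_div_of_nonneg_left hnum hpos (by linarith)⟩
end

section
/- Let S ≥ 0, b > 0, n > 0, and let σαβ², σ² ≥ 0 with σαβ² + σ²/n > 0. For positive reals b', n' define λ(b', n') = b'·S / (σαβ² + σ²/n'). Then for every real t ≥ 1, λ(t·b, n) ≥ λ(b, t·n); that is, scaling the number of levels b of the random factor B increases the noncentrality parameter at least as much as scaling the number of replicates n by the same factor. -/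
/-- Pivot effect for the model `A × B` with `B` random: scaling the number of
levels `b` of the random factor `B` by `t ≥ 1` increases the noncentrality
parameter `λ(b, n) = b·S / (σαβ² + σ²/n)` at least as much as scaling the
number of replicates `n` by the same factor. -/
theorem stmt_17 (S b n σαβ2 σ2 : ℝ) (hS : 0 ≤ S) (hb : 0 < b) (hn : 0 < n)
    (hαβ : 0 ≤ σαβ2) (hσ : 0 ≤ σ2)
    (hpos : 0 < σαβ2 + σ2 / n)
    (lam : ℝ → ℝ → ℝ)
    (hlam : ∀ b' n' : ℝ, 0 < b' → 0 < n' →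
      lam b' n' = b' * S / (σαβ2 + σ2 / n')) :
    ∀ t : ℝ, 1 ≤ t → lam (t * b) n ≥ lam b (t * n) := by
  intro t ht
  have ht0 : 0 < t := by linarith
  rw [hlam _ _ (mul_pos ht0 hb) hn, hlam _ _ hb (mul_pos ht0 hn)]
  have hq : σ2 / (t * n) = (σ2 / n) / t := by
    rw [div_div, mul_comm]
  rw [hq]
  have hq0 : 0 ≤ σ2 / n := div_nonneg hσ hn.le
  generalize σ2 / n = q at *
  have hle : σαβ2 + q ≤ t * σαβ2 + q := by nlinarith
  have he : b * S / (σαβ2 + q / t) = t * b * S / (t * σαβ2 + q) := by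
    have h1 : t * σαβ2 + q = t * (σαβ2 + q / t) := by field_simp
    rw [h1, mul_assoc, mul_div_mul_left _ _ ht0.ne']
  rw [he, ge_iff_le]
  exact div_le_div_of_nonneg_left (by positivity) hpos hle
end
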